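/- Let W̄' be the set of reduced words w in F_n (including ε) with w_1 ≠ a_1, w_1 w_2 ≠ a_2 a_1^{-1}, w_fin ≠ a_1^{-1}, and w_{fin-1} w_fin ≠ a_1 a_2^{-1}, and set W̄ = (W̄' ∪ {a_1^{-1}}) \ {a_2}. Then the classes {p̂_w : w ∈ W̄} form a basis of Ĉ(F_n) = C(F_n)/K(F_n). -/

import Mathlib

open List Finset

/-- Number of occurrences of `w` as a contiguous subword of `v`. -/
def occ {α : Type*} [DecidableEq α] (w v : List α) : ℕ :=
  ((List.range (v.length + 1 - w.length)).filter (fun i => decide (w <+: v.drop i))).length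

/-- Elementary counting function, with the convention `p_ε(v) = |v|`. -/
def cnt {α : Type*} [DecidableEq α] (w v : List α) : ℚ :=
  if w = [] then v.length else occ w v

/-- The inverse of a letter of `S̄`: letters are pairs (generator, sign). -/
def invL {n : ℕ} (a : Fin n × Bool) : Fin n × Bool := (a.1, !a.2)

/-- The inverse of a (reduced) word. -/
def invW {n : ℕ} (w : List (Fin n × Bool)) : List (Fin n × Bool) := (w.map invL).reverse

def redB {n : ℕ} : List (Fin n × Bool) → Bool
  | a :: b :: t => decide (b ≠ invL a) && redB (b :: t)
  | _ => true

/-- A word over `S̄` is reduced if no letter is followed by its inverse. -/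
def Red {n : ℕ} (w : List (Fin n × Bool)) : Prop := redB w = true

instance {n : ℕ} : DecidablePred (Red (n := n)) := fun _ => instDecidableEqBool _ _

/-- Left extension relation `l_w = p_w - Σ_{s : sw reduced} p_{sw}`. -/
def lgrp {n : ℕ} (w v : List (Fin n × Bool)) : ℚ :=
  cnt w v - ∑ s ∈ Finset.univ.filter (fun s => Red (s :: w)), cnt (s :: w) v

/-- Right extension relation `r_w = p_w - Σ_{s : ws reduced} p_{ws}`. -/
def rgrp {n : ℕ} (w v : List (Fin n × Bool)) : ℚ :=
  cnt w v - ∑ s ∈ Finset.univ.filter (fun s => Red (w ++ [s])), cnt (w ++ [s]) v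

/-- The map `σ₁` sending a function on F_n to `f - f ∘ (·⁻¹)`; on counting functions
it sends `p_w` to the Brooks quasimorphism `φ_w = p_w - p_{w⁻¹}`. -/
def sig1 {n : ℕ} (f : List (Fin n × Bool) → ℚ) : List (Fin n × Bool) → ℚ :=
  fun v => f v - f (invW v)

/-- The Brooks quasimorphism `φ_w = p_w - p_{w⁻¹}` of a nonempty reduced word. -/
def brooks {n : ℕ} (w v : List (Fin n × Bool)) : ℚ := (occ w v : ℚ) - (occ (invW w) v : ℚ)

/-- The set W̄' of reduced words (including ε) with `w₁ ≠ a₁`, `w₁w₂ ≠ a₂a₁⁻¹`,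
`w_fin ≠ a₁⁻¹`, `w_{fin-1}w_fin ≠ a₁a₂⁻¹`. -/
def WbarAux (n : ℕ) (hn : 2 ≤ n) : Set (List (Fin n × Bool)) :=
  {w | Red w ∧ w.head? ≠ some ((⟨0, by omega⟩ : Fin n), true) ∧
    w.take 2 ≠ [((⟨1, hn⟩ : Fin n), true), ((⟨0, by omega⟩ : Fin n), false)] ∧
    w.getLast? ≠ some ((⟨0, by omega⟩ : Fin n), false) ∧
    w.reverse.take 2 ≠ [((⟨1, hn⟩ : Fin n), false), ((⟨0, by omega⟩ : Fin n), true)]}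

/-- The set W̄ = (W̄' ∪ {a₁⁻¹}) \ {a₂}. -/
def Wbar (n : ℕ) (hn : 2 ≤ n) : Set (List (Fin n × Bool)) :=
  (WbarAux n hn ∪ {[((⟨0, by omega⟩ : Fin n), false)]}) \ {[((⟨1, hn⟩ : Fin n), true)]}


section CntGeneral
variable {α : Type*} [DecidableEq α]

theorem prefix_app_iff {w p y : List α} (h : w.length ≤ p.length) :
    w <+: p ++ y ↔ w <+: p :=
  ⟨fun h' => List.prefix_of_prefix_length_le h' (List.prefix_append p y) h,
    fun h' => h'.trans (List.prefix_append p y)⟩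

theorem cnt_nil_right (w : List α) : cnt w [] = 0 := by
  unfold cnt occ
  cases w <;> simp

theorem cnt_cons (w : List α) (c : α) (v : List α) :
    cnt w (c :: v) = cnt w v + (if w <+: c :: v then 1 else 0) := by
  unfold cnt
  by_cases hw : w = []
  · subst hw; simp
  · simp only [hw, if_false]
    unfold occ
    by_cases hl : w.length ≤ v.length + 1
    · have h1 : (c :: v).length + 1 - w.length = (v.length + 1 - w.length) + 1 := by
        simp only [List.length_cons]; omega
      rw [h1, List.range_succ_eq_map, List.filter_cons, List.filter_map]
      simp only [List.drop_zero, decide_eq_true_eq]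
      split_ifs with h
      · simp [Function.comp_def]
      · simp [Function.comp_def]
    · have h1 : (c :: v).length + 1 - w.length = 0 := by
        simp only [List.length_cons]; omega
      have h2 : v.length + 1 - w.length = 0 := by omega
      have h3 : ¬ w <+: c :: v := by
        intro h
        have := h.length_le
        simp only [List.length_cons] at this
        omega
      rw [h1, h2]
      simp [h3]

theorem cnt_snoc (w : List α) (v : List α) (c : α) :
    cnt w (v ++ [c]) = cnt w v + (if w <:+ v ++ [c] then 1 else 0) := by
  by_cases hw : w = []
  · subst hw; simp [cnt]
  induction v with
  | nil =>
    rw [List.nil_append, cnt_cons, cnt_nil_right]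
    congr 1
    have : w <+: [c] ↔ w <:+ [c] := by
      constructor
      · intro h
        rcases w with _ | ⟨x, _ | ⟨y, t⟩⟩
        · simp
        · simp at h; simp [h]
        · simpa using h.length_le
      · intro h
        rcases w with _ | ⟨x, _ | ⟨y, t⟩⟩
        · simp
        · have := h.eq_of_length (by simp); simp [this]
        · simpa using h.length_le
    simp only [this]
  | cons d v ih =>
    rw [List.cons_append, cnt_cons, ih, cnt_cons]
    by_cases hl : w.length ≤ v.length + 1
    · have h1 : w <+: d :: (v ++ [c]) ↔ w <+: d :: v := by
        rw [← List.cons_append, prefix_app_iff]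
        · 
          simpa using hl
      have h2 : w <:+ d :: (v ++ [c]) ↔ w <:+ v ++ [c] := by
        rw [List.suffix_cons_iff]
        constructor
        · rintro (h | h)
          · subst h; simp at hl
          · exact h
        · exact Or.inr
      simp only [h1, h2]
      ring
    · have h1 : ¬ w <+: d :: v := fun h => hl (by simpa using h.length_le)
      have h2 : ¬ w <:+ v ++ [c] := fun h => hl (by simpa using h.length_le)
      have h3 : w <+: d :: (v ++ [c]) ↔ w <:+ d :: (v ++ [c]) := by
        constructor
        · intro h
          have := h.eq_of_length (by have := h.length_le; simp at *; omega)
          rw [this]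
        · intro h
          have := h.eq_of_length (by have := h.length_le; simp at *; omega)
          rw [this]
      simp only [h1, h2, h3, if_false, add_zero]

theorem cnt_reverse (w v : List α) : cnt w.reverse v.reverse = cnt w v := by
  induction v with
  | nil => simp [cnt_nil_right]
  | cons c v ih =>
    rw [List.reverse_cons, cnt_snoc, cnt_cons, ih, ← List.reverse_cons]
    simp only [List.reverse_suffix]

theorem cnt_glue (u p A y : List α) (h : u.length ≤ A.length + 1) :
    cnt u (p ++ A ++ y) + cnt u A = cnt u (p ++ A) + cnt u (A ++ y) := by
  induction p with
  | nil => simp; ring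
  | cons c p ih =>
    simp only [List.cons_append] at *
    rw [cnt_cons, cnt_cons]
    have h1 : u <+: c :: (p ++ A ++ y) ↔ u <+: c :: (p ++ A) := by
      rw [← List.cons_append, prefix_app_iff]
      simp only [List.length_cons, List.length_append]; omega
    simp only [h1]
    linarith

theorem cnt_lt (u w : List α) (hu : u ≠ []) (h : w.length < u.length) : cnt u w = 0 := by
  have : w.length + 1 - u.length = 0 := by omega
  simp [cnt, occ, hu, this]

theorem cnt_le (u w : List α) (hu : u ≠ []) (h : w.length ≤ u.length) :
    cnt u w = if u = w then 1 else 0 := by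
  cases w with
  | nil => simp [cnt_nil_right, hu]
  | cons c v =>
    rw [cnt_cons, cnt_lt u v hu (by simpa using h)]
    have : u <+: c :: v ↔ u = c :: v :=
      ⟨fun h' => h'.eq_of_length (le_antisymm h'.length_le h), fun h' => h' ▸ List.prefix_rfl⟩
    simp [this]

theorem cnt_rep (u : List α) (a : α) (hu : u ≠ []) (hh : u.head? ≠ some a) (k : ℕ) (y : List α) :
    cnt u (List.replicate k a ++ y) = cnt u y := by
  induction k with
  | zero => simp
  | succ k ih =>
    rw [List.replicate_succ, List.cons_append, cnt_cons, ih]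
    cases u with
    | nil => exact absurd rfl hu
    | cons x u =>
      have : ¬ x = a := by simpa using hh
      simp [List.cons_prefix_cons, this]

end CntGeneral

section RedSec
variable {n : ℕ}

abbrev Ltr (n : ℕ) := Fin n × Bool

theorem invL_invL (a : Ltr n) : invL (invL a) = a := by simp [invL]

theorem invL_ne (a : Ltr n) : invL a ≠ a := by
  intro h
  have := congrArg Prod.snd h
  simp [invL] at this

theorem red_iff (w : List (Ltr n)) : Red w ↔ List.IsChain (fun x y => y ≠ invL x) w := by
  unfold Red
  induction w with
  | nil => simp [redB]
  | cons a w ih =>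
    cases w with
    | nil => simp [redB]
    | cons b t =>
      rw [redB, List.isChain_cons_cons, ← ih]
      simp

theorem red_cons_cons (a b : Ltr n) (w : List (Ltr n)) :
    Red (a :: b :: w) ↔ b ≠ invL a ∧ Red (b :: w) := by
  simp [red_iff, List.isChain_cons_cons]

theorem red_single (a : Ltr n) : Red [a] := by simp [red_iff]

theorem red_nil : Red ([] : List (Ltr n)) := by simp [red_iff]

theorem red_tail {a : Ltr n} {w : List (Ltr n)} (h : Red (a :: w)) : Red w := by
  rw [red_iff] at *
  exact h.tail

theorem red_reverse (w : List (Ltr n)) : Red w.reverse ↔ Red w := by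
  rw [red_iff, red_iff, List.isChain_reverse]
  have : (fun x y : Ltr n => x ≠ invL y) = (fun x y => y ≠ invL x) := by
    funext x y
    apply propext
    constructor
    · intro h h'; apply h; rw [h', invL_invL]
    · intro h h'; apply h; rw [h', invL_invL]
  have h2 : flip (fun x y : Ltr n => y ≠ invL x) = (fun x y => y ≠ invL x) := this
  first | rw [h2] | simp only [this]

theorem red_prefix {w v : List (Ltr n)} (h : w <+: v) (hv : Red v) : Red w := by
  rw [red_iff] at *
  exact hv.prefix h

theorem red_glue (p A y : List (Ltr n)) (hA : A ≠ []) (h1 : Red (p ++ A)) (h2 : Red (A ++ y)) :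
    Red (p ++ A ++ y) := by
  induction p with
  | nil => simpa using h2
  | cons c p ih =>
    have h3 := ih (red_tail h1)
    cases p with
    | nil =>
      cases A with
      | nil => exact absurd rfl hA
      | cons d A =>
        simp only [List.cons_append, List.nil_append, red_cons_cons] at *
        exact ⟨h1.1, h3⟩
    | cons d p =>
      simp only [List.cons_append, red_cons_cons] at *
      exact ⟨h1.1, h3⟩

theorem red_rep (k : ℕ) (a : Ltr n) (w : List (Ltr n)) (hw : Red w)
    (hh : w.head? ≠ some (invL a)) : Red (List.replicate k a ++ w) := by
  induction k with
  | zero => simpa using hw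
  | succ k ih =>
    rw [List.replicate_succ, List.cons_append]
    cases k with
    | zero =>
      cases w with
      | nil => exact red_single a
      | cons c w =>
        simp at hh
        simp [red_cons_cons, hh, hw]
    | succ k =>
      rw [List.replicate_succ, List.cons_append] at *
      rw [red_cons_cons]
      exact ⟨(invL_ne a).symm, ih⟩

theorem lgrp_eq (w v : List (Ltr n)) (hv : Red v) :
    lgrp w v = (if w <+: v then 1 else 0) - (if w = [] then 1 else 0) := by
  induction v with
  | nil =>
    have : (w <+: ([] : List (Ltr n))) ↔ w = [] := by simp
    simp [lgrp, cnt_nil_right]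
  | cons c v ih =>
    have ih' := ih (red_tail hv)
    have key : ∑ s ∈ Finset.univ.filter (fun s => Red (s :: w)), cnt (s :: w) (c :: v)
        = ∑ s ∈ Finset.univ.filter (fun s => Red (s :: w)), cnt (s :: w) v
          + (if w <+: v then 1 else 0) := by
      simp only [cnt_cons, Finset.sum_add_distrib, List.cons_prefix_cons]
      congr 1
      by_cases hp : w <+: v
      · have hc : Red (c :: w) := red_prefix (by simpa [List.cons_prefix_cons] using hp) hv
        simp only [hp, and_true, if_true]
        rw [Finset.sum_ite_eq' ]
        simp [hc]
      · simp [hp]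
    unfold lgrp at *
    rw [key, cnt_cons]
    linarith

theorem rgrp_eq (w v : List (Ltr n)) : rgrp w v = lgrp w.reverse v.reverse := by
  unfold rgrp lgrp
  rw [cnt_reverse]
  congr 1
  have h : ∀ s : Ltr n, s :: w.reverse = (w ++ [s]).reverse := by intro s; simp
  simp only [h, cnt_reverse, red_reverse]

theorem lgrp_bd (w v : List (Ltr n)) (hv : Red v) : |lgrp w v| ≤ 1 := by
  rw [lgrp_eq w v hv]
  by_cases h : w = []
  · simp [h]
  · simp only [h, if_false, sub_zero]
    split_ifs <;> simp

theorem rgrp_bd (w v : List (Ltr n)) (hv : Red v) : |rgrp w v| ≤ 1 := by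
  rw [rgrp_eq]
  exact lgrp_bd _ _ ((red_reverse v).2 hv)

/-- functions bounded on reduced words -/
def Bdd (n : ℕ) : Submodule ℚ (List (Ltr n) → ℚ) where
  carrier := {f | ∃ C : ℚ, ∀ v, Red v → |f v| ≤ C}
  zero_mem' := ⟨0, by simp⟩
  add_mem' := by
    rintro f g ⟨C, hC⟩ ⟨D, hD⟩
    exact ⟨C + D, fun v hv => (abs_add_le _ _).trans (add_le_add (hC v hv) (hD v hv))⟩
  smul_mem' := by
    rintro c f ⟨C, hC⟩
    refine ⟨|c| * C, fun v hv => ?_⟩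
    simp only [Pi.smul_apply, smul_eq_mul, abs_mul]
    exact mul_le_mul_of_nonneg_left (hC v hv) (abs_nonneg c)

theorem Lall (T : Submodule ℚ (List (Ltr n) → ℚ)) (hT : Bdd n ≤ T) (u : List (Ltr n))
    (h : ∀ s, Red (s :: u) → cnt (s :: u) ∈ T) : cnt u ∈ T := by
  have h1 : lgrp u ∈ T := hT ⟨1, fun v hv => lgrp_bd u v hv⟩
  have h2 : ∑ s ∈ Finset.univ.filter (fun s => Red (s :: u)), cnt (s :: u) ∈ T :=
    T.sum_mem fun s hs => h s (by simpa using hs)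
  have h3 : cnt u = lgrp u + ∑ s ∈ Finset.univ.filter (fun s => Red (s :: u)), cnt (s :: u) := by
    funext v; simp [lgrp]
  rw [h3]
  exact T.add_mem h1 h2

theorem Lone (T : Submodule ℚ (List (Ltr n) → ℚ)) (hT : Bdd n ≤ T) (x : Ltr n) (u : List (Ltr n))
    (hx : Red (x :: u)) (hu : cnt u ∈ T)
    (h : ∀ s, s ≠ x → Red (s :: u) → cnt (s :: u) ∈ T) : cnt (x :: u) ∈ T := by
  have h1 : lgrp u ∈ T := hT ⟨1, fun v hv => lgrp_bd u v hv⟩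
  have h2 : ∑ s ∈ (Finset.univ.filter (fun s => Red (s :: u))).erase x, cnt (s :: u) ∈ T :=
    T.sum_mem fun s hs => by
      simp at hs
      exact h s hs.1 hs.2
  have h3 : cnt (x :: u) = cnt u - lgrp u -
      ∑ s ∈ (Finset.univ.filter (fun s => Red (s :: u))).erase x, cnt (s :: u) := by
    funext v
    have := Finset.add_sum_erase (Finset.univ.filter (fun s => Red (s :: u)))
      (fun s => cnt (s :: u) v) (a := x) (by simpa using hx)
    simp only [Pi.sub_apply, Finset.sum_apply, lgrp]
    linarith
  rw [h3]
  exact T.sub_mem (T.sub_mem hu h1) h2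

theorem Rall (T : Submodule ℚ (List (Ltr n) → ℚ)) (hT : Bdd n ≤ T) (u : List (Ltr n))
    (h : ∀ s, Red (u ++ [s]) → cnt (u ++ [s]) ∈ T) : cnt u ∈ T := by
  have h1 : rgrp u ∈ T := hT ⟨1, fun v hv => rgrp_bd u v hv⟩
  have h2 : ∑ s ∈ Finset.univ.filter (fun s => Red (u ++ [s])), cnt (u ++ [s]) ∈ T :=
    T.sum_mem fun s hs => h s (by simpa using hs)
  have h3 : cnt u = rgrp u + ∑ s ∈ Finset.univ.filter (fun s => Red (u ++ [s])), cnt (u ++ [s]) := by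
    funext v; simp [rgrp]
  rw [h3]
  exact T.add_mem h1 h2

theorem Rone (T : Submodule ℚ (List (Ltr n) → ℚ)) (hT : Bdd n ≤ T) (x : Ltr n) (u : List (Ltr n))
    (hx : Red (u ++ [x])) (hu : cnt u ∈ T)
    (h : ∀ s, s ≠ x → Red (u ++ [s]) → cnt (u ++ [s]) ∈ T) : cnt (u ++ [x]) ∈ T := by
  have h1 : rgrp u ∈ T := hT ⟨1, fun v hv => rgrp_bd u v hv⟩
  have h2 : ∑ s ∈ (Finset.univ.filter (fun s => Red (u ++ [s]))).erase x, cnt (u ++ [s]) ∈ T :=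
    T.sum_mem fun s hs => by
      simp at hs
      exact h s hs.1 hs.2
  have h3 : cnt (u ++ [x]) = cnt u - rgrp u -
      ∑ s ∈ (Finset.univ.filter (fun s => Red (u ++ [s]))).erase x, cnt (u ++ [s]) := by
    funext v
    have := Finset.add_sum_erase (Finset.univ.filter (fun s => Red (u ++ [s])))
      (fun s => cnt (u ++ [s]) v) (a := x) (by simpa using hx)
    simp only [Pi.sub_apply, Finset.sum_apply, rgrp]
    linarith
  rw [h3]
  exact T.sub_mem (T.sub_mem hu h1) h2

/-- left-good words -/
def LG (a b : Ltr n) (w : List (Ltr n)) : Prop :=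
  w.head? ≠ some a ∧ w.take 2 ≠ [b, invL a]

theorem LG_change (a b x s : Ltr n) (u : List (Ltr n)) (hx : Red (x :: u))
    (hbad : ¬ LG a b (x :: u)) (hsx : s ≠ x) (hs : Red (s :: u)) : LG a b (s :: u) := by
  unfold LG at *
  cases u with
  | nil =>
    simp at *
    exact fun h => hsx (h.trans hbad.symm)
  | cons y u =>
    simp [red_cons_cons] at *
    have := invL_invL a
    refine ⟨?_, ?_⟩
    · rintro rfl
      have h1 := hbad (Ne.symm hsx)
      exact hs.1 h1.2
    · rintro rfl rfl
      by_cases h : x = a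
      · subst h; exact hx.1 rfl
      · exact hsx (hbad h).1.symm

theorem LG_rev (a b x s : Ltr n) (u : List (Ltr n)) (hu : 2 ≤ u.length)
    (h : LG a b (x :: u).reverse) : LG a b (s :: u).reverse := by
  unfold LG at *
  rcases hr : u.reverse with _ | ⟨c, _ | ⟨d, t⟩⟩
  · have := congrArg List.length hr; simp at this; simp [this] at hu
  · have := congrArg List.length hr; simp at this; omega
  · simpa [hr] using h

theorem span_all (a b : Ltr n) (hba : b ≠ a) (hba' : b ≠ invL a)
    (T : Submodule ℚ (List (Ltr n) → ℚ)) (hT : Bdd n ≤ T)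
    (hA : cnt [invL a] ∈ T) (h0 : cnt [] ∈ T)
    (hgood : ∀ w, Red w → LG a b w → LG (invL a) (invL b) w.reverse → w ≠ [b] → cnt w ∈ T) :
    ∀ w, Red w → cnt w ∈ T := by
  have s1 : ∀ s, s ≠ a → s ≠ b → cnt [s] ∈ T := by
    intro s hsa hsb
    by_cases hs : s = invL a
    · rw [hs]; exact hA
    · apply hgood _ (red_single s)
      · simp [LG, hsa]
      · simp [LG, hs]
      · simpa using hsb
  have s2 : ∀ x y, x ≠ a → y ≠ invL a → Red [x, y] → cnt [x, y] ∈ T := by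
    intro x y hx hy hr
    apply hgood _ hr
    · simp [LG, hx, hy]
    · simp [LG, hx, hy, invL_invL]
    · simp
  have s3 : ∀ s, s ≠ a → s ≠ b → cnt [s, invL a] ∈ T := by
    intro s hsa hsb
    have hr : Red [s, invL a] := by
      rw [red_cons_cons]
      refine ⟨fun h => hsa ?_, red_single _⟩
      rw [← invL_invL s, ← h, invL_invL]
    refine Rone T hT (invL a) [s] hr (s1 s hsa hsb) ?_
    intro t ht hrt
    exact s2 s t hsa ht hrt
  have ra : ∀ s, Red [s, invL a] → s ≠ a := by
    rintro s hr rfl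
    rw [red_cons_cons] at hr
    exact hr.1 rfl
  have rb : Red [b, invL a] := by
    rw [red_cons_cons]
    refine ⟨fun h => hba ?_, red_single _⟩
    rw [← invL_invL b, ← h, invL_invL]
  have s4 : cnt [b, invL a] ∈ T := by
    refine Lone T hT b [invL a] rb hA ?_
    intro s hs hr
    exact s3 s (ra s hr) hs
  have s5 : cnt [b] ∈ T := by
    refine Rall T hT [b] ?_
    intro t hr
    by_cases ht : t = invL a
    · subst ht; exact s4
    · exact s2 b t hba ht hr
  have s6 : ∀ s, cnt [s] ∈ T := by
    intro s
    by_cases hb : s = b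
    · rw [hb]; exact s5
    by_cases ha : s = a
    · subst ha
      refine Lone T hT s [] (red_single s) h0 ?_
      intro t ht _
      by_cases htb : t = b
      · rw [htb]; exact s5
      · exact s1 t ht htb
    · exact s1 s ha hb
  have s7 : ∀ x y, Red [x, y] → cnt [x, y] ∈ T := by
    intro x y hr
    by_cases hy : y = invL a
    · subst hy
      by_cases hx : x = b
      · subst hx; exact s4
      · exact s3 x (ra x hr) hx
    · by_cases hx : x = a
      · subst hx
        refine Lone T hT x [y] hr (s6 y) ?_
        intro s hs hrs
        exact s2 s y hs hy hrs
      · exact s2 x y hx hy hr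
  have main : ∀ N : ℕ, ∀ w : List (Ltr n), w.length = N → Red w → cnt w ∈ T := by
    intro N
    induction N using Nat.strong_induction_on with
    | _ N ih =>
    intro w hN hr
    by_cases h3 : w.length < 3
    · rcases w with _ | ⟨x, _ | ⟨y, _ | ⟨z, t⟩⟩⟩
      · exact h0
      · exact s6 x
      · exact s7 x y hr
      · simp only [List.length_cons] at h3; omega
    have h3' : 3 ≤ w.length := by omega
    have g1 : ∀ w : List (Ltr n), w.length = N → 3 ≤ w.length → Red w →
        LG (invL a) (invL b) w.reverse → cnt w ∈ T := by
      intro w hN h3 hr hR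
      by_cases hL : LG a b w
      · apply hgood w hr hL hR
        rintro rfl
        simp at h3
      · cases w with
        | nil => exact h0
        | cons x u =>
          simp at h3 hN
          refine Lone T hT x u hr (ih u.length (by omega) u rfl (red_tail hr)) ?_
          intro s hs hrs
          apply hgood _ hrs (LG_change a b x s u hr hL hs hrs)
            (LG_rev _ _ x s u (by omega) hR)
          intro h
          have := congrArg List.length h
          simp at this
          simp [this] at h3
    by_cases hR : LG (invL a) (invL b) w.reverse
    · exact g1 w hN h3' hr hR
    · rcases List.eq_nil_or_concat w with h | ⟨u, x, h⟩
      · rw [h]; exact h0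
      · 
        subst h
        simp at h3' hN
        have hr' : Red (x :: u.reverse) := by
          have := (red_reverse _).2 hr
          simpa using this
        have hru : Red u := red_prefix (List.prefix_append u [x]) (by simpa using hr)
        have := Rone T hT x u (by simpa using hr) (ih u.length (by omega) u rfl hru) ?_
        · simpa using this
        intro s hs hrs
        refine g1 _ (by simpa using hN) (by simp; omega) hrs ?_
        have hrs' : Red (s :: u.reverse) := by
          have := (red_reverse _).2 hrs
          simpa using this
        have := LG_change (invL a) (invL b) x s u.reverse hr' (by simpa using hR) hs hrs'
        simpa using this
  intro w hr
  exact main _ w rfl hr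

/-- padding on the left by `a^N` or `a^N b`. -/
def padL (a b : Ltr n) (N : ℕ) (y : List (Ltr n)) : List (Ltr n) :=
  List.replicate N a ++ ((if y.head? = some (invL a) then [b] else []) ++ y)

theorem red_padL (a b : Ltr n) (hba : b ≠ a) (hba' : b ≠ invL a) (N : ℕ) (y : List (Ltr n))
    (hy : Red y) : Red (padL a b N y) := by
  unfold padL
  apply red_rep
  · split_ifs with h
    · cases y with
      | nil => exact red_single b
      | cons c y =>
        simp at h
        subst h
        simp only [List.cons_append, List.nil_append, red_cons_cons]
        refine ⟨fun h => hba ?_, hy⟩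
        rw [← invL_invL b, ← h, invL_invL]
    · simpa using hy
  · split_ifs with h
    · simpa using hba'
    · simpa using h

theorem cnt_padL (a b : Ltr n) (N : ℕ) (u y : List (Ltr n)) (hu : u ≠ []) (hL : LG a b u)
    (hb : y.head? = some (invL a) → u ≠ [b]) : cnt u (padL a b N y) = cnt u y := by
  unfold padL
  rw [cnt_rep u a hu hL.1]
  split_ifs with h
  · rw [List.singleton_append, cnt_cons]
    have hb' := hb h
    have : ¬ u <+: b :: y := by
      intro hp
      rcases y with _ | ⟨c, y⟩
      · simp at h
      · simp at h
        subst h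
        rcases u with _ | ⟨p, _ | ⟨q, t⟩⟩
        · exact hu rfl
        · simp [List.cons_prefix_cons] at hp; simp [hp] at hb'
        · simp only [List.cons_prefix_cons] at hp
          apply hL.2
          simp [hp.1, hp.2.1]
    simp [this]
  · simp

/-- padding on both sides -/
def hat (a b : Ltr n) (N : ℕ) (w : List (Ltr n)) : List (Ltr n) :=
  padL a b N (padL (invL a) (invL b) N w.reverse).reverse

theorem hat_shape (a b : Ltr n) (N : ℕ) (w : List (Ltr n)) :
    ∃ m, hat a b N w = List.replicate N a ++ m ++ List.replicate N (invL a) := by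
  unfold hat
  generalize hY : (padL (invL a) (invL b) N w.reverse).reverse = Y
  have hY' : ∃ m', Y = m' ++ List.replicate N (invL a) := by
    refine ⟨((if w.reverse.head? = some (invL (invL a)) then [invL b] else []) ++
      w.reverse).reverse, ?_⟩
    rw [← hY, padL, List.reverse_append, List.reverse_replicate]
  obtain ⟨m', hm'⟩ := hY'
  refine ⟨(if Y.head? = some (invL a) then [b] else []) ++ m', ?_⟩
  rw [padL]
  conv_lhs => rw [hm']
  conv_rhs => rw [hm']
  simp only [List.append_assoc]

theorem invL_inj {a b : Ltr n} (h : invL a = invL b) : a = b := by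
  rw [← invL_invL a, h, invL_invL]

theorem red_hat (a b : Ltr n) (hba : b ≠ a) (hba' : b ≠ invL a) (N : ℕ) (w : List (Ltr n))
    (hw : Red w) : Red (hat a b N w) := by
  unfold hat
  apply red_padL a b hba hba'
  rw [red_reverse]
  apply red_padL
  · exact fun h => hba (invL_inj h)
  · exact fun h => hba' (invL_inj h)
  · rwa [red_reverse]

theorem cnt_hat (a b : Ltr n) (N : ℕ) (u w : List (Ltr n)) (hu : u ≠ []) (hL : LG a b u)
    (hR : LG (invL a) (invL b) u.reverse) (hb : u ≠ [b])
    (hB : w.getLast? = some a → u ≠ [invL b]) : cnt u (hat a b N w) = cnt u w := by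
  unfold hat
  rw [cnt_padL a b N u _ hu hL (fun _ => hb), ← cnt_reverse, List.reverse_reverse, cnt_padL,
    cnt_reverse]
  · simpa using hu
  · exact hR
  · intro h h'
    rw [invL_invL, List.head?_reverse] at h
    apply hB h
    rw [← List.reverse_reverse u, h']
    rfl

theorem indep (a b : Ltr n) (hba : b ≠ a) (hba' : b ≠ invL a)
    (x : List (Ltr n) →₀ ℚ) (hxr : ∀ u ∈ x.support, Red u)
    (hx : ∀ u ∈ x.support, u ≠ [b] ∧ (u = [] ∨ u = [invL a] ∨
      (LG a b u ∧ LG (invL a) (invL b) u.reverse)))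
    (C : ℚ) (hC : ∀ v, Red v → |∑ u ∈ x.support, x u * cnt u v| ≤ C) : x = 0 := by
  set f : List (Ltr n) → ℚ := fun v => ∑ u ∈ x.support, x u * cnt u v with hf
  obtain ⟨N, hN⟩ : ∃ N : ℕ, ∀ u ∈ x.support, u.length ≤ N :=
    ⟨x.support.sup List.length, fun u hu => Finset.le_sup (f := List.length) hu⟩
  have glue : ∀ p A y : List (Ltr n), N ≤ A.length + 1 →
      f (p ++ A ++ y) + f A = f (p ++ A) + f (A ++ y) := by
    intro p A y hA
    simp only [hf, ← Finset.sum_add_distrib, ← mul_add]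
    refine Finset.sum_congr rfl fun u hu => ?_
    rw [cnt_glue u p A y ((hN u hu).trans hA)]
  have cyc : ∀ v : List (Ltr n), v ≠ [] → N ≤ v.length + 1 → Red (v ++ v) → f (v ++ v) = f v := by
    intro v hv hl hr
    have hrv : Red v := red_prefix (List.prefix_append v v) hr
    have key : ∀ k : ℕ, ∃ q, Red (q ++ v) ∧ f (q ++ v) = f v + k * (f (v ++ v) - f v) := by
      intro k
      induction k with
      | zero => exact ⟨[], by simpa using hrv, by simp⟩
      | succ k ih =>
        obtain ⟨q, h1, h2⟩ := ih
        refine ⟨q ++ v, red_glue q v v hv h1 hr, ?_⟩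
        have := glue q v v hl
        push_cast
        linarith
    by_contra hne
    have hd : 0 < |f (v ++ v) - f v| := abs_pos.2 (sub_ne_zero.2 hne)
    obtain ⟨k, hk⟩ := exists_nat_gt ((C + |f v|) / |f (v ++ v) - f v|)
    rw [div_lt_iff₀ hd] at hk
    obtain ⟨q, h1, h2⟩ := key k
    have h3 : |f (q ++ v)| ≤ C := hC _ h1
    have h4 : (k : ℚ) * (f (v ++ v) - f v) = f (q ++ v) - f v := by linarith
    have h5 : (k : ℚ) * |f (v ++ v) - f v| = |f (q ++ v) - f v| := by
      rw [← h4, abs_mul, Nat.abs_cast]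
    have h6 := abs_sub (f (q ++ v)) (f v)
    linarith
  set M := N + 1 with hM
  have red_repl : ∀ (c : Ltr n) k, Red (List.replicate k c) := by
    intro c k
    have := red_rep k c [] red_nil (by simp)
    simpa using this
  have cycrep : ∀ c : Ltr n, f (List.replicate M c ++ List.replicate M c)
      = f (List.replicate M c) := by
    intro c
    apply cyc
    · simp [hM, List.replicate_succ]
    · simp [hM]; omega
    · rw [List.replicate_append_replicate]; exact red_repl _ _
  -- the empty word
  have e0 : ([] : List (Ltr n)) ∉ x.support := by
    intro hmem
    have h1 := cycrep a
    have h2 : ∀ k, f (List.replicate k a) = x [] * k := by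
      intro k
      simp only [hf]
      rw [Finset.sum_eq_single_of_mem [] hmem]
      · simp [cnt]
      · intro u hu hne
        have : cnt u (List.replicate k a ++ []) = 0 := by
          rw [cnt_rep u a hne, cnt_nil_right]
          rcases (hx u hu).2 with h | h | h
          · exact absurd h hne
          · rw [h]; simpa using invL_ne a
          · exact h.1.1
        rw [List.append_nil] at this
        rw [this, mul_zero]
    rw [List.replicate_append_replicate, h2, h2] at h1
    have h3 : x [] ≠ 0 := by simpa using hmem
    have h4 : x [] * (M : ℚ) = 0 := by push_cast at h1; linarith
    rw [hM] at h4
    push_cast at h4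
    rcases mul_eq_zero.1 h4 with h | h
    · exact h3 h
    · have : (0 : ℚ) ≤ N := Nat.cast_nonneg N
      linarith
  have eA : [invL a] ∉ x.support := by
    intro hmem
    have h1 := cycrep (invL a)
    have hc : ∀ k, cnt [invL a] (List.replicate k (invL a)) = k := by
      intro k
      induction k with
      | zero => simp [cnt_nil_right]
      | succ k ih => rw [List.replicate_succ, cnt_cons, ih]; simp [List.cons_prefix_cons]
    have h2 : ∀ k, f (List.replicate k (invL a)) = x [invL a] * k := by
      intro k
      simp only [hf]
      rw [Finset.sum_eq_single_of_mem _ hmem]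
      · rw [hc]
      · intro u hu hne
        have hu0 : u ≠ [] := fun h => e0 (h ▸ hu)
        have : cnt u.reverse (List.replicate k (invL a) ++ []) = 0 := by
          rw [cnt_rep u.reverse (invL a) (by simpa using hu0), cnt_nil_right]
          rcases (hx u hu).2 with h | h | h
          · exact absurd h hu0
          · exact absurd h hne
          · exact h.2.1
        rw [List.append_nil, ← List.reverse_replicate, cnt_reverse] at this
        rw [this, mul_zero]
    rw [List.replicate_append_replicate, h2, h2] at h1
    have h3 : x [invL a] ≠ 0 := by simpa using hmem
    have h4 : x [invL a] * (M : ℚ) = 0 := by push_cast at h1; linarith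
    rw [hM] at h4
    push_cast at h4
    rcases mul_eq_zero.1 h4 with h | h
    · exact h3 h
    · have : (0 : ℚ) ≤ N := Nat.cast_nonneg N
      linarith
  have hx' : ∀ u ∈ x.support, u ≠ [b] ∧ u ≠ [] ∧ LG a b u ∧ LG (invL a) (invL b) u.reverse := by
    intro u hu
    have hu0 : u ≠ [] := fun h => e0 (h ▸ hu)
    have huA : u ≠ [invL a] := fun h => eA (h ▸ hu)
    rcases hx u hu with ⟨h1, h | h | h⟩
    · exact absurd h hu0
    · exact absurd h huA
    · exact ⟨h1, hu0, h⟩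
  obtain ⟨c, hc⟩ : ∃ c, ∀ w, Red w → f (hat a b M w) = c := by
    set P := List.replicate M a with hP
    set Q := List.replicate M (invL a) with hQ
    have hPl : P.length = M := by simp [hP]
    have hQl : Q.length = M := by simp [hQ]
    have hP0 : P ≠ [] := by intro h; rw [h] at hPl; simp [hM] at hPl
    have hQ0 : Q ≠ [] := by intro h; rw [h] at hQl; simp [hM] at hQl
    have rbP : Red (b :: P) := by
      rw [hP, hM, List.replicate_succ, red_cons_cons]
      refine ⟨fun h => hba' ?_, ?_⟩
      · rw [h, invL_invL]
      · rw [← List.replicate_succ]; exact red_repl _ _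
    have rQbP : Red (Q ++ b :: P) := by
      apply red_rep _ _ _ rbP
      simpa [invL_invL] using hba
    refine ⟨f P + f Q - f (Q ++ b :: P), fun w hw => ?_⟩
    have hred := red_hat a b hba hba' M w hw
    obtain ⟨m, hm⟩ := hat_shape a b M w
    rw [hm] at hred ⊢
    rw [← hP, ← hQ] at hred ⊢
    -- v = b P m Q
    have r1 : Red ([b] ++ P ++ (m ++ Q)) :=
      red_glue [b] P (m ++ Q) hP0 rbP (by simpa using hred)
    have r2 : Red (Q ++ (b :: P) ++ (m ++ Q)) :=
      red_glue Q (b :: P) (m ++ Q) (by simp) rQbP (by simpa using r1)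
    have r3 : Red (([b] ++ P ++ m) ++ Q ++ ([b] ++ P ++ m ++ Q)) :=
      red_glue _ Q _ hQ0 (by simpa using r1) (by simpa using r2)
    have c1 := cyc ([b] ++ P ++ m ++ Q) (by simp) (by simp [hPl, hQl]; omega) r3
    have g1 := glue ([b] ++ P ++ m) Q ([b] ++ P ++ m ++ Q) (by omega)
    have g2 := glue Q (b :: P) (m ++ Q) (by simp [hPl]; omega)
    have g3 := glue [b] P (m ++ Q) (by omega)
    simp only [List.append_assoc, List.cons_append, List.nil_append] at c1 g1 g2 g3 ⊢
    linarith
  have hlow : ∀ w, (w.getLast? = some a → [invL b] ∉ x.support) → Red w → f w = c := by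
    intro w h hw
    rw [← hc w hw]
    simp only [hf]
    refine Finset.sum_congr rfl fun u hu => ?_
    obtain ⟨h1, h2, h3, h4⟩ := hx' u hu
    rw [cnt_hat a b M u w h2 h3 h4 h1]
    intro h' h''
    exact h h' (h'' ▸ hu)
  have hc0 : c = 0 := by
    rw [← hlow [b] (by simp [hba]) (red_single b)]
    simp only [hf]
    refine Finset.sum_eq_zero fun u hu => ?_
    obtain ⟨h1, h2, h3, h4⟩ := hx' u hu
    rw [cnt_le u [b] h2 (List.length_pos_iff.2 h2), if_neg h1, mul_zero]
  have hmin : ∀ w ∈ x.support, (∀ u ∈ x.support, w.length ≤ u.length) → f w = x w := by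
    intro w hw h
    simp only [hf]
    rw [Finset.sum_eq_single_of_mem w hw]
    · rw [cnt_le w w (hx' w hw).2.1 le_rfl]; simp
    · intro u hu hne
      rw [cnt_le u w (hx' u hu).2.1 (h u hu), if_neg hne, mul_zero]
  have eB : [invL b] ∉ x.support := by
    intro hmem
    have h1 := hlow [invL b] (by
      intro h
      exfalso
      simp at h
      apply hba'
      rw [← h, invL_invL]) (red_single _)
    rw [hmin _ hmem (fun u hu => List.length_pos_iff.2 (hx' u hu).2.1), hc0] at h1
    simp at hmem
    exact hmem h1
  by_contra hne
  have hs : x.support.Nonempty := by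
    rw [Finset.nonempty_iff_ne_empty]
    simpa using hne
  obtain ⟨w, hw, hwm⟩ := Finset.exists_min_image x.support List.length hs
  have h1 := hlow w (fun _ => eB) (hxr w hw)
  rw [hmin w hw hwm, hc0] at h1
  simp at hw
  exact hw h1

end RedSec

/-- The classes of p_w, for w ∈ W̄, form a basis of Ĉ(F_n) = C(F_n)/K(F_n):
they span every counting function modulo bounded functions, and no nontrivial
combination of them is bounded. -/
theorem stmt_17 (n : ℕ) (hn : 2 ≤ n) :
    (∀ f ∈ Submodule.span ℚ {g : List (Fin n × Bool) → ℚ | ∃ w, Red w ∧ g = cnt w},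
      ∃ g ∈ Submodule.span ℚ
          {g : List (Fin n × Bool) → ℚ | ∃ w ∈ Wbar n hn, g = cnt w},
        ∃ C : ℚ, ∀ v : List (Fin n × Bool), Red v → |f v - g v| ≤ C) ∧
    (∀ x : List (Fin n × Bool) →₀ ℚ, (∀ w ∈ x.support, w ∈ Wbar n hn) →
      (∃ C : ℚ, ∀ v : List (Fin n × Bool), Red v →
        |∑ u ∈ x.support, x u * cnt u v| ≤ C) → x = 0) := by
  set a : Ltr n := ((⟨0, by omega⟩ : Fin n), true) with ha
  set b : Ltr n := ((⟨1, hn⟩ : Fin n), true) with hb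
  have hA : invL a = ((⟨0, by omega⟩ : Fin n), false) := rfl
  have hB : invL b = ((⟨1, hn⟩ : Fin n), false) := rfl
  have hba : b ≠ a := by simp [ha, hb]
  have hba' : b ≠ invL a := by simp [hA, hb]
  have hW : ∀ w, w ∈ WbarAux n hn ↔
      Red w ∧ LG a b w ∧ LG (invL a) (invL b) w.reverse := by
    intro w
    simp only [WbarAux, LG, Set.mem_setOf_eq, invL_invL, List.head?_reverse]
    rw [hA, hB]
    tauto
  have hW' : ∀ w, w ∈ Wbar n hn ↔ (w ∈ WbarAux n hn ∨ w = [invL a]) ∧ w ≠ [b] := by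
    intro w
    simp only [Wbar, Set.mem_diff, Set.mem_union, Set.mem_singleton_iff]
    rw [hA]
  constructor
  · set S := Submodule.span ℚ {g : List (Ltr n) → ℚ | ∃ w ∈ Wbar n hn, g = cnt w} with hS
    have hmem : ∀ w ∈ Wbar n hn, cnt w ∈ S ⊔ Bdd n := fun w hw =>
      (le_sup_left : S ≤ S ⊔ Bdd n) (Submodule.subset_span ⟨w, hw, rfl⟩)
    have hall := span_all a b hba hba' (S ⊔ Bdd n) le_sup_right
      (hmem _ ((hW' _).2 ⟨Or.inr rfl, by simpa using hba'.symm⟩))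
      (hmem _ ((hW' _).2 ⟨Or.inl ((hW _).2 ⟨red_nil, by simp [LG], by simp [LG]⟩), by simp⟩))
      (fun w h1 h2 h3 h4 => hmem _ ((hW' _).2 ⟨Or.inl ((hW _).2 ⟨h1, h2, h3⟩), h4⟩))
    intro f hf
    have hle : Submodule.span ℚ {g : List (Ltr n) → ℚ | ∃ w, Red w ∧ g = cnt w} ≤ S ⊔ Bdd n := by
      rw [Submodule.span_le]
      rintro g ⟨w, hw, rfl⟩
      exact hall w hw
    obtain ⟨g, hg, k, ⟨C, hC⟩, rfl⟩ := Submodule.mem_sup.1 (hle hf)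
    refine ⟨g, hg, C, fun v hv => ?_⟩
    simpa using hC v hv
  · rintro x hx ⟨C, hC⟩
    refine indep a b hba hba' x ?_ ?_ C hC
    · intro u hu
      rcases ((hW' u).1 (hx u hu)).1 with h | h
      · exact ((hW u).1 h).1
      · rw [h]; exact red_single _
    · intro u hu
      obtain ⟨h, h2⟩ := (hW' u).1 (hx u hu)
      refine ⟨h2, Or.inr ?_⟩
      rcases h with h | h
      · exact Or.inr ((hW u).1 h).2
      · exact Or.inl h
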